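/- arXiv:math/0701898 — 3 statements merged into one kernel-verified Lean document; each statement's English description precedes it below -/
import Mathlib

section
/- Let N ≥ 1 be an integer and let ε > 0 and 0 < δ < N be real numbers. Then there exists a constant c = c(N, ε, δ) > 0 such that for every a > 0, every b ≥ 0 and every ζ ∈ ℝ^N one has ∫_{ℝ^N} (|η| + a)^{−(N+ε)} (|η − ζ| + b)^{−(N−δ)} dη ≤ c · a^{−ε} · (|ζ| + a + b)^{−(N−δ)}. -/
open MeasureTheory

/-- The power `‖x‖ ^ (-p)` with `p < dim E` is integrable on the unit ball. -/
theorem integrableOn_unitBall_norm_rpow_neg {E : Type*} [NormedAddCommGroup E] [NormedSpace ℝ E]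
    [MeasurableSpace E] [BorelSpace E] [FiniteDimensional ℝ E] (μ : Measure E)
    [μ.IsAddHaarMeasure] (hE : 1 ≤ Module.finrank ℝ E) {p : ℝ}
    (hp : p < Module.finrank ℝ E) :
    IntegrableOn (fun x : E => ‖x‖ ^ (-p)) (Metric.ball 0 1) μ := by
  refine integrableOn_ball_of_norm_le_rpow hE hp (C := 1) (.of_forall fun x => ?_)
    (Measurable.aestronglyMeasurable (by fun_prop))
  rw [one_mul, Real.norm_of_nonneg (by positivity)]

/-- The kernel product is dominated by a rescaled Japanese bracket plus a rescaled truncated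
Riesz kernel centred at `z`. -/
theorem rpow_norm_add_mul_rpow_norm_sub_add_le {E : Type*} [NormedAddCommGroup E]
    [NormedSpace ℝ E] {a b p q R : ℝ} {x z : E} (ha : 0 < a) (hb : 0 ≤ b) (hp : 0 ≤ p)
    (hq : 0 ≤ q) (hR : 4 * R = ‖z‖ + a + b) (hxz : x ≠ z) :
    (‖x‖ + a) ^ (-q) * (‖x - z‖ + b) ^ (-p) ≤
      R ^ (-p) * a ^ (-q) * (1 + ‖a⁻¹ • x‖) ^ (-q) +
        R ^ (-q) * R ^ (-p) *
          (Metric.ball (0 : E) 1).indicator (fun y => ‖y‖ ^ (-p)) (R⁻¹ • (x - z)) := by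
  have hz := norm_nonneg z
  have hx := norm_nonneg x
  have hR0 : 0 < R := by linarith
  have hd : 0 < ‖x - z‖ := norm_pos_iff.2 (sub_ne_zero.2 hxz)
  have hind : 0 ≤ (Metric.ball (0 : E) 1).indicator (fun y => ‖y‖ ^ (-p)) (R⁻¹ • (x - z)) :=
    Set.indicator_nonneg (fun y _ => by positivity) _
  have hbracket : a ^ (-q) * (1 + ‖a⁻¹ • x‖) ^ (-q) = (‖x‖ + a) ^ (-q) := by
    rw [← Real.mul_rpow ha.le (by positivity), norm_smul, Real.norm_of_nonneg (by positivity)]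
    congr 1
    field_simp
    ring
  rw [mul_assoc (R ^ (-p)), hbracket]
  rcases le_or_gt R (‖x - z‖ + b) with h | h
  · have h1 : (‖x - z‖ + b) ^ (-p) ≤ R ^ (-p) :=
      Real.rpow_le_rpow_of_nonpos hR0 h (by linarith)
    have h2 : (‖x‖ + a) ^ (-q) * (‖x - z‖ + b) ^ (-p) ≤ (‖x‖ + a) ^ (-q) * R ^ (-p) := by
      gcongr
    have h3 : 0 ≤ R ^ (-q) * R ^ (-p) *
        (Metric.ball (0 : E) 1).indicator (fun y => ‖y‖ ^ (-p)) (R⁻¹ • (x - z)) := by positivity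
    linarith
  · have hmem : R⁻¹ • (x - z) ∈ Metric.ball (0 : E) 1 := by
      rw [mem_ball_zero_iff, norm_smul, Real.norm_of_nonneg (by positivity),
        inv_mul_lt_one₀ hR0]
      linarith
    have htri : ‖z‖ ≤ ‖x‖ + ‖x - z‖ := by
      simpa using norm_sub_le x (x - z)
    have h1 : (‖x‖ + a) ^ (-q) ≤ R ^ (-q) :=
      Real.rpow_le_rpow_of_nonpos hR0 (by linarith) (by linarith)
    have h2 : (‖x - z‖ + b) ^ (-p) ≤ ‖x - z‖ ^ (-p) :=
      Real.rpow_le_rpow_of_nonpos hd (by linarith) (by linarith)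
    have h3 : R ^ (-p) * ‖R⁻¹ • (x - z)‖ ^ (-p) = ‖x - z‖ ^ (-p) := by
      rw [← Real.mul_rpow hR0.le (by positivity), norm_smul, Real.norm_of_nonneg (by positivity),
        mul_inv_cancel_left₀ hR0.ne']
    rw [Set.indicator_of_mem hmem, mul_assoc (R ^ (-q)), h3]
    have h4 : (‖x‖ + a) ^ (-q) * (‖x - z‖ + b) ^ (-p) ≤ R ^ (-q) * ‖x - z‖ ^ (-p) := by
      gcongr
    have h5 : 0 ≤ R ^ (-p) * (‖x‖ + a) ^ (-q) := by positivity
    linarith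

/-- For `N ≥ 1`, `ε > 0` and `0 < δ < N` there is a constant
`c = c(N, ε, δ) > 0` such that for all `a > 0`, `b ≥ 0` and `ζ ∈ ℝ^N`,
`∫_{ℝ^N} (|η|+a)^{-(N+ε)} (|η-ζ|+b)^{-(N-δ)} dη ≤ c a^{-ε} (|ζ|+a+b)^{-(N-δ)}`. -/
theorem statement0 (N : ℕ) (hN : 1 ≤ N) (ε δ : ℝ) (hε : 0 < ε) (hδ0 : 0 < δ)
    (hδN : δ < (N : ℝ)) :
    ∃ c : ℝ, 0 < c ∧ ∀ (a b : ℝ) (ζ : EuclideanSpace ℝ (Fin N)), 0 < a → 0 ≤ b →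
      (∫ η : EuclideanSpace ℝ (Fin N),
          (‖η‖ + a) ^ (-((N : ℝ) + ε)) * (‖η - ζ‖ + b) ^ (-((N : ℝ) - δ)))
        ≤ c * a ^ (-ε) * (‖ζ‖ + a + b) ^ (-((N : ℝ) - δ)) := by
  have hfin : Module.finrank ℝ (EuclideanSpace ℝ (Fin N)) = N := by simp
  set q : ℝ := (N : ℝ) + ε with hq
  set p : ℝ := (N : ℝ) - δ with hp
  have hq0 : 0 < q := by positivity
  have hp0 : 0 < p := by linarith
  let J : EuclideanSpace ℝ (Fin N) → ℝ := fun x => (1 + ‖x‖) ^ (-q)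
  let K : EuclideanSpace ℝ (Fin N) → ℝ :=
    (Metric.ball 0 1).indicator (fun y => ‖y‖ ^ (-p))
  have hJ : Integrable J := integrable_one_add_norm (by rw [hfin]; linarith)
  have hK : Integrable K := (integrable_indicator_iff Metric.isOpen_ball.measurableSet).2
    (integrableOn_unitBall_norm_rpow_neg volume (by rwa [hfin]) (by rw [hfin]; linarith))
  have hJ0 : 0 ≤ ∫ x, J x := integral_nonneg fun x => by positivity
  have hK0 : 0 ≤ ∫ x, K x :=
    integral_nonneg fun x => Set.indicator_nonneg (fun y _ => by positivity) _
  have : Nontrivial (EuclideanSpace ℝ (Fin N)) :=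
    Module.nontrivial_of_finrank_pos (R := ℝ) (by rwa [hfin])
  refine ⟨4 ^ p * ((∫ x, J x) + 4 ^ ε * ∫ x, K x) + 1, by positivity, fun a b ζ ha hb => ?_⟩
  have hζ := norm_nonneg ζ
  obtain ⟨R, hR⟩ : ∃ R : ℝ, 4 * R = ‖ζ‖ + a + b := ⟨(‖ζ‖ + a + b) / 4, by ring⟩
  have hR0 : 0 < R := by linarith
  have hJa : Integrable fun x => R ^ (-p) * a ^ (-q) * J (a⁻¹ • x) :=
    (hJ.comp_smul (inv_ne_zero ha.ne')).const_mul _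
  have hKR : Integrable fun x => R ^ (-q) * R ^ (-p) * K (R⁻¹ • (x - ζ)) :=
    ((hK.comp_smul (inv_ne_zero hR0.ne')).comp_sub_right ζ).const_mul _
  have hscale : ∀ t : ℝ, 0 < t → t ^ (-q) * t ^ N = t ^ (-ε) := fun t ht => by
    rw [← Real.rpow_natCast, ← Real.rpow_add ht, hq]
    congr 1
    ring
  have h4 : R ^ (-ε) ≤ 4 ^ ε * a ^ (-ε) := by
    calc R ^ (-ε) ≤ (a / 4) ^ (-ε) :=
          Real.rpow_le_rpow_of_nonpos (by positivity) (by linarith) (by linarith)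
      _ = 4 ^ ε * a ^ (-ε) := by
          rw [Real.div_rpow ha.le (by norm_num), Real.rpow_neg (by norm_num : (0 : ℝ) ≤ 4),
            div_inv_eq_mul, mul_comm]
  have h4p : R ^ (-p) = 4 ^ p * (‖ζ‖ + a + b) ^ (-p) := by
    rw [← hR, Real.mul_rpow (by norm_num) hR0.le, ← mul_assoc,
      ← Real.rpow_add (by norm_num), add_neg_cancel, Real.rpow_zero, one_mul]
  calc ∫ η, (‖η‖ + a) ^ (-q) * (‖η - ζ‖ + b) ^ (-p)
      ≤ ∫ η, (R ^ (-p) * a ^ (-q) * J (a⁻¹ • η) + R ^ (-q) * R ^ (-p) * K (R⁻¹ • (η - ζ))) := by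
        refine integral_mono_of_nonneg (.of_forall fun η => by positivity) (hJa.add hKR) ?_
        filter_upwards [Measure.ae_ne volume ζ] with η hη
        exact rpow_norm_add_mul_rpow_norm_sub_add_le ha hb hp0.le hq0.le hR hη
    _ = R ^ (-p) * (a ^ (-q) * a ^ N) * (∫ x, J x) +
          R ^ (-p) * (R ^ (-q) * R ^ N) * ∫ x, K x := by
        rw [integral_add hJa hKR, integral_const_mul, integral_const_mul,
          integral_sub_right_eq_self (fun x => K (R⁻¹ • x)) ζ,
          Measure.integral_comp_inv_smul_of_nonneg volume J ha.le,
          Measure.integral_comp_inv_smul_of_nonneg volume K hR0.le, hfin]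
        simp only [smul_eq_mul]
        ring
    _ = R ^ (-p) * a ^ (-ε) * (∫ x, J x) + R ^ (-p) * R ^ (-ε) * ∫ x, K x := by
        rw [hscale a ha, hscale R hR0]
    _ ≤ R ^ (-p) * a ^ (-ε) * (∫ x, J x) + R ^ (-p) * (4 ^ ε * a ^ (-ε)) * ∫ x, K x := by
        gcongr
    _ = 4 ^ p * ((∫ x, J x) + 4 ^ ε * ∫ x, K x) * a ^ (-ε) * (‖ζ‖ + a + b) ^ (-p) := by
        rw [h4p]
        ring
    _ ≤ (4 ^ p * ((∫ x, J x) + 4 ^ ε * ∫ x, K x) + 1) * a ^ (-ε) * (‖ζ‖ + a + b) ^ (-p) := by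
        gcongr
        linarith
end

section
/- Let n ≥ 2, 1 < p < ∞ and a ∈ ℝ. Let 𝒬 be a nonnegative measurable function on {ζ = (ζ′, ζ_n) ∈ ℝ^{n−1} × ℝ : ζ_n > −1} such that A := ∫_{ℝ^n_+} 𝒬(ζ′, ζ_n − 1) ζ_n^{−a−1/p} dζ < ∞. Then for every f ∈ L_p(ℝ^n_+, x_n^{ap} dx), the integral Qf(x) := x_n^{−n} ∫_{ℝ^n_+} 𝒬((y − x)/x_n) f(y) dy converges absolutely for almost every x ∈ ℝ^n_+, and ‖Qf‖_{L_p(ℝ^n_+, x_n^{ap} dx)} ≤ A · ‖f‖_{L_p(ℝ^n_+, x_n^{ap} dx)}. -/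
open MeasureTheory

/-- The open upper half-space `ℝ^n_+` with `n = d+1`, i.e. the set of points whose last
coordinate is positive. -/
def upperHalf (d : ℕ) : Set (EuclideanSpace ℝ (Fin (d + 1))) :=
  {x | 0 < x (Fin.last d)}

open scoped ENNReal

/-- Jensen-type consequence of Hölder's inequality for an integral with weight `k`. -/
theorem ENNReal.rpow_lintegral_mul_le {α : Type*} [MeasurableSpace α] {μ : Measure α} {p : ℝ}
    (hp : 1 < p) {k F : α → ℝ≥0∞} (hk : AEMeasurable k μ) (hF : AEMeasurable F μ) :
    (∫⁻ z, k z * F z ∂μ) ^ p ≤ (∫⁻ z, k z ∂μ) ^ (p - 1) * ∫⁻ z, k z * F z ^ p ∂μ := by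
  have hp0 : 0 < p := by linarith
  have hpq := Real.HolderConjugate.conjExponent hp
  set q := p.conjExponent with hq
  have hsum : 1 / q + 1 / p = 1 := by
    have := hpq.inv_add_inv_eq_one
    simp only [one_div]; linarith
  have h := ENNReal.lintegral_mul_le_Lp_mul_Lq μ hpq.symm
    (f := fun z => k z ^ (1 / q)) (g := fun z => k z ^ (1 / p) * F z)
    (hk.pow_const _) ((hk.pow_const _).mul hF)
  have e1 : ∀ z, ((fun z => k z ^ (1 / q)) * fun z => k z ^ (1 / p) * F z) z = k z * F z := by
    intro z
    simp only [Pi.mul_apply]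
    rw [← mul_assoc, ← ENNReal.rpow_add_of_nonneg _ _ hpq.symm.one_div_nonneg hpq.one_div_nonneg,
      hsum, ENNReal.rpow_one]
  have e2 : ∀ z, (k z ^ (1 / q)) ^ q = k z := by
    intro z
    rw [← ENNReal.rpow_mul, one_div_mul_cancel hpq.symm.ne_zero, ENNReal.rpow_one]
  have e3 : ∀ z, (k z ^ (1 / p) * F z) ^ p = k z * F z ^ p := by
    intro z
    rw [ENNReal.mul_rpow_of_nonneg _ _ hp0.le, ← ENNReal.rpow_mul,
      one_div_mul_cancel hp0.ne', ENNReal.rpow_one]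
  simp only [e1, e2, e3] at h
  refine (ENNReal.rpow_le_rpow h hp0.le).trans_eq ?_
  rw [ENNReal.mul_rpow_of_nonneg _ _ hp0.le, ← ENNReal.rpow_mul, ← ENNReal.rpow_mul,
    one_div_mul_cancel hp0.ne', ENNReal.rpow_one]
  congr 2
  have : 1 / q = 1 - 1 / p := by linarith
  rw [this]
  field_simp

/-- An affine change of variables preserving a set `s`, for lower Lebesgue integrals. -/
theorem setLIntegral_comp_linearMap_add {E : Type*} [NormedAddCommGroup E] [NormedSpace ℝ E]
    [MeasurableSpace E] [BorelSpace E] [FiniteDimensional ℝ E] (μ : Measure E)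
    [μ.IsAddHaarMeasure] {L : E →ₗ[ℝ] E} (hL : LinearMap.det L ≠ 0) (v : E) {s : Set E}
    (hs : MeasurableSet s) (hLs : ∀ x, L x + v ∈ s ↔ x ∈ s) {g : E → ℝ≥0∞} (hg : Measurable g) :
    ∫⁻ x in s, g (L x + v) ∂μ
      = ENNReal.ofReal |(LinearMap.det L)⁻¹| * ∫⁻ y in s, g y ∂μ := by
  have hLm : Measurable L := L.continuous_of_finiteDimensional.measurable
  have hgs : Measurable (s.indicator g) := hg.indicator hs
  have h1 : ∀ x, s.indicator (fun x => g (L x + v)) x = s.indicator g (L x + v) := by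
    intro x
    by_cases hx : x ∈ s
    · rw [Set.indicator_of_mem hx, Set.indicator_of_mem ((hLs x).2 hx)]
    · rw [Set.indicator_of_notMem hx, Set.indicator_of_notMem (mt (hLs x).1 hx)]
  rw [← lintegral_indicator hs, ← lintegral_indicator hs]
  simp only [h1]
  rw [← lintegral_map (f := fun y => s.indicator g (y + v)) (g := L)
    (hgs.comp (measurable_add_const v)) hLm,
    Measure.map_linearMap_addHaar_eq_smul_addHaar μ hL, lintegral_smul_measure,
    lintegral_add_right_eq_self, smul_eq_mul]

theorem measurableSet_upperHalf (d : ℕ) : MeasurableSet (upperHalf d) :=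
  measurableSet_lt measurable_const (by fun_prop)

/-- The dilation `ζ ↦ x + x_n (ζ - e_n)` maps the half-space onto itself. -/
theorem setLIntegral_upperHalf_dilation (d : ℕ) {x : EuclideanSpace ℝ (Fin (d + 1))}
    (hx : x ∈ upperHalf d) {g : EuclideanSpace ℝ (Fin (d + 1)) → ℝ≥0∞} (hg : Measurable g) :
    ∫⁻ y in upperHalf d, g y = ENNReal.ofReal (x (Fin.last d) ^ (d + 1)) *
      ∫⁻ ζ in upperHalf d,
        g (x + x (Fin.last d) • (ζ - EuclideanSpace.single (Fin.last d) (1 : ℝ))) := by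
  have hc : 0 < x (Fin.last d) := hx
  set c := x (Fin.last d) with hcdef
  set e := EuclideanSpace.single (Fin.last d) (1 : ℝ) with he
  have hdet : LinearMap.det (c • (LinearMap.id : EuclideanSpace ℝ (Fin (d + 1)) →ₗ[ℝ] _))
      = c ^ (d + 1) := by simp
  have h := setLIntegral_comp_linearMap_add volume
    (L := c • (LinearMap.id : EuclideanSpace ℝ (Fin (d + 1)) →ₗ[ℝ] _))
    (by rw [hdet]; positivity) (x - c • e) (measurableSet_upperHalf d)
    (by intro z; simp [upperHalf, he, ← hcdef, hc]) hg
  have harg : ∀ ζ, (c • (LinearMap.id : EuclideanSpace ℝ (Fin (d + 1)) →ₗ[ℝ] _)) ζ + (x - c • e)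
      = x + c • (ζ - e) := by
    intro ζ
    simp only [LinearMap.smul_apply, LinearMap.id_apply, smul_sub]
    abel
  simp only [harg, hdet] at h
  rw [h, ← mul_assoc, ← ENNReal.ofReal_mul (by positivity), abs_of_pos (by positivity),
    mul_inv_cancel₀ (by positivity), ENNReal.ofReal_one, one_mul]

/-- Change of variables `x ↦ x + x_n (ζ - e_n)` in the half-space, for fixed `ζ`. -/
theorem setLIntegral_upperHalf_comp_shear (d : ℕ) {ζ : EuclideanSpace ℝ (Fin (d + 1))}
    (hζ : ζ ∈ upperHalf d) {g : EuclideanSpace ℝ (Fin (d + 1)) → ℝ≥0∞} (hg : Measurable g) :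
    ∫⁻ x in upperHalf d,
        g (x + x (Fin.last d) • (ζ - EuclideanSpace.single (Fin.last d) (1 : ℝ)))
      = ENNReal.ofReal (ζ (Fin.last d))⁻¹ * ∫⁻ y in upperHalf d, g y := by
  have hc : 0 < ζ (Fin.last d) := hζ
  set e := EuclideanSpace.single (Fin.last d) (1 : ℝ) with he
  let φ : EuclideanSpace ℝ (Fin (d + 1)) →ₗ[ℝ] ℝ :=
    (EuclideanSpace.proj (Fin.last d) : EuclideanSpace ℝ (Fin (d + 1)) →L[ℝ] ℝ).toLinearMap
  have hφ : ∀ x, φ x = x (Fin.last d) := fun x => rfl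
  have hdet : LinearMap.det (LinearMap.transvection φ (ζ - e)) = ζ (Fin.last d) := by
    rw [LinearMap.transvection.det, hφ]
    simp [he]
  have h := setLIntegral_comp_linearMap_add volume (L := LinearMap.transvection φ (ζ - e))
    (by rw [hdet]; exact hc.ne') 0 (measurableSet_upperHalf d)
    (by
      intro z
      have : z (Fin.last d) + z (Fin.last d) * (ζ (Fin.last d) - 1)
        = z (Fin.last d) * ζ (Fin.last d) := by ring
      simp [upperHalf, he, LinearMap.transvection.apply, hφ, this, hc]) hg
  simp only [add_zero, LinearMap.transvection.apply, hφ, hdet] at h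
  rw [h, abs_of_pos (by positivity)]

/-- Weighted `L_p` estimate, in `ℝ≥0∞`, for averages of `g` over the dilations
`x ↦ x + x_n (ζ - e_n)` of the half-space. -/
theorem lintegral_upperHalf_dilation_average_le (d : ℕ) {p : ℝ} (a : ℝ) (hp : 1 < p)
    {q g : EuclideanSpace ℝ (Fin (d + 1)) → ℝ≥0∞} (hq : Measurable q) (hg : Measurable g) :
    ∫⁻ x in upperHalf d,
        (∫⁻ ζ in upperHalf d,
          q ζ * g (x + x (Fin.last d) • (ζ - EuclideanSpace.single (Fin.last d) (1 : ℝ)))) ^ p *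
          ENNReal.ofReal (x (Fin.last d) ^ (a * p))
      ≤ (∫⁻ ζ in upperHalf d, q ζ * ENNReal.ofReal (ζ (Fin.last d) ^ (-a - 1 / p))) ^ p *
        ∫⁻ x in upperHalf d, g x ^ p * ENNReal.ofReal (x (Fin.last d) ^ (a * p)) := by
  have hp0 : 0 < p := by linarith
  have hH := measurableSet_upperHalf d
  set e := EuclideanSpace.single (Fin.last d) (1 : ℝ) with he
  set k : EuclideanSpace ℝ (Fin (d + 1)) → ℝ≥0∞ :=
    fun ζ => q ζ * ENNReal.ofReal (ζ (Fin.last d) ^ (-a - 1 / p)) with hk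
  set F : EuclideanSpace ℝ (Fin (d + 1)) → EuclideanSpace ℝ (Fin (d + 1)) → ℝ≥0∞ :=
    fun x ζ => g (x + x (Fin.last d) • (ζ - e)) *
      ENNReal.ofReal (ζ (Fin.last d) ^ (a + 1 / p)) with hF
  set h : EuclideanSpace ℝ (Fin (d + 1)) → ℝ≥0∞ :=
    fun x => g x ^ p * ENNReal.ofReal (x (Fin.last d) ^ (a * p)) with hh
  set A := ∫⁻ ζ in upperHalf d, k ζ
  have hkm : Measurable k := by fun_prop
  have hFm : Measurable (Function.uncurry F) := by
    simp only [hF, Function.uncurry_def]; fun_prop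
  have hhm : Measurable h := by fun_prop
  have hprod : ∀ x, ∫⁻ ζ in upperHalf d, q ζ * g (x + x (Fin.last d) • (ζ - e))
      = ∫⁻ ζ in upperHalf d, k ζ * F x ζ := by
    intro x
    refine setLIntegral_congr_fun hH fun ζ hζ => ?_
    have hζ' : 0 < ζ (Fin.last d) := hζ
    have h1 : ENNReal.ofReal (ζ (Fin.last d) ^ (-a - 1 / p)) *
        ENNReal.ofReal (ζ (Fin.last d) ^ (a + 1 / p)) = 1 := by
      rw [← ENNReal.ofReal_mul (by positivity), ← Real.rpow_add hζ']
      simp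
    simp only [hk, hF]
    calc _ = q ζ * g (x + x (Fin.last d) • (ζ - e)) * 1 := by rw [mul_one]
      _ = _ := by rw [← h1]; ring
  have hinner : ∀ ζ ∈ upperHalf d,
      ∫⁻ x in upperHalf d, F x ζ ^ p * ENNReal.ofReal (x (Fin.last d) ^ (a * p))
        = ∫⁻ x in upperHalf d, h x := by
    intro ζ hζ
    have hζ' : 0 < ζ (Fin.last d) := hζ
    have h1 : ∀ x ∈ upperHalf d,
        F x ζ ^ p * ENNReal.ofReal (x (Fin.last d) ^ (a * p))
          = ENNReal.ofReal (ζ (Fin.last d)) * h (x + x (Fin.last d) • (ζ - e)) := by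
      intro x hx
      have hx' : 0 < x (Fin.last d) := hx
      have hlast : (x + x (Fin.last d) • (ζ - e)) (Fin.last d)
          = x (Fin.last d) * ζ (Fin.last d) := by
        simp [he]; ring
      have hpow : (ζ (Fin.last d) ^ (a + 1 / p)) ^ p * x (Fin.last d) ^ (a * p)
          = ζ (Fin.last d) * (x (Fin.last d) * ζ (Fin.last d)) ^ (a * p) := by
        rw [← Real.rpow_mul hζ'.le, Real.mul_rpow hx'.le hζ'.le]
        have : (a + 1 / p) * p = a * p + 1 := by field_simp
        rw [this, Real.rpow_add hζ', Real.rpow_one]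
        ring
      simp only [hF, hh, hlast]
      rw [ENNReal.mul_rpow_of_nonneg _ _ hp0.le,
        ENNReal.ofReal_rpow_of_nonneg (by positivity) hp0.le, mul_assoc,
        ← ENNReal.ofReal_mul (by positivity), hpow, ENNReal.ofReal_mul hζ'.le]
      ring
    rw [setLIntegral_congr_fun hH h1, lintegral_const_mul _ (by fun_prop),
      setLIntegral_upperHalf_comp_shear d hζ hhm, ← mul_assoc, ← ENNReal.ofReal_mul hζ'.le,
      mul_inv_cancel₀ hζ'.ne', ENNReal.ofReal_one, one_mul]
  calc
    _ = ∫⁻ x in upperHalf d, (∫⁻ ζ in upperHalf d, k ζ * F x ζ) ^ p *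
          ENNReal.ofReal (x (Fin.last d) ^ (a * p)) := by simp only [hprod]
    _ ≤ ∫⁻ x in upperHalf d, A ^ (p - 1) * ∫⁻ ζ in upperHalf d, k ζ * (F x ζ ^ p *
          ENNReal.ofReal (x (Fin.last d) ^ (a * p))) := by
        refine lintegral_mono fun x => ?_
        have hFx : Measurable (F x) := hFm.of_uncurry_left
        refine (mul_le_mul_left (ENNReal.rpow_lintegral_mul_le hp hkm.aemeasurable
          hFx.aemeasurable) _).trans_eq ?_
        rw [mul_assoc, ← lintegral_mul_const _ (by fun_prop)]
        simp only [mul_assoc, A]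
    _ = A ^ (p - 1) * ∫⁻ ζ in upperHalf d, ∫⁻ x in upperHalf d, k ζ * (F x ζ ^ p *
          ENNReal.ofReal (x (Fin.last d) ^ (a * p))) := by
        have hm : Measurable (Function.uncurry fun x ζ => k ζ * (F x ζ ^ p *
            ENNReal.ofReal (x (Fin.last d) ^ (a * p)))) :=
          (hkm.comp measurable_snd).mul ((hFm.pow_const p).mul (by fun_prop))
        rw [← lintegral_lintegral_swap hm.aemeasurable]
        exact lintegral_const_mul _ hm.lintegral_prod_right'
    _ = A ^ (p - 1) * ∫⁻ ζ in upperHalf d, k ζ * ∫⁻ x in upperHalf d, h x := by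
        congr 1
        refine setLIntegral_congr_fun hH fun ζ hζ => ?_
        have hFζ : Measurable fun x => F x ζ := hFm.of_uncurry_right
        simp only
        rw [lintegral_const_mul _ (by fun_prop), hinner ζ hζ]
    _ = A ^ p * ∫⁻ x in upperHalf d, h x := by
        rw [lintegral_mul_const _ hkm, ← mul_assoc]
        change A ^ (p - 1) * A * _ = _
        nth_rewrite 2 [← ENNReal.rpow_one A]
        rw [← ENNReal.rpow_add_of_nonneg _ _ (by linarith) zero_le_one, sub_add_cancel]

/-- Weighted `L_p` bound for the dilation-invariant integral operator
`Qf(x) = x_n^{-n} ∫_{ℝ^n_+} 𝒬((y-x)/x_n) f(y) dy`: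
if `A = ∫_{ℝ^n_+} 𝒬(ζ', ζ_n - 1) ζ_n^{-a-1/p} dζ < ∞` then for every
`f ∈ L_p(ℝ^n_+, x_n^{ap} dx)` the defining integral converges absolutely for a.e. `x`
and `‖Qf‖ ≤ A ‖f‖` in `L_p(ℝ^n_+, x_n^{ap} dx)`.  (Here `n = d + 1 ≥ 2`.) -/
theorem statement1 (d : ℕ) (hd : 1 ≤ d) (p a : ℝ) (hp : 1 < p)
    (Q : EuclideanSpace ℝ (Fin (d + 1)) → ℝ) (hQmeas : Measurable Q)
    (hQnonneg : ∀ ζ : EuclideanSpace ℝ (Fin (d + 1)), -1 < ζ (Fin.last d) → 0 ≤ Q ζ)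
    (hQint : IntegrableOn
      (fun ζ : EuclideanSpace ℝ (Fin (d + 1)) =>
        Q (ζ - EuclideanSpace.single (Fin.last d) (1 : ℝ)) * (ζ (Fin.last d)) ^ (-a - 1 / p))
      (upperHalf d))
    (f : EuclideanSpace ℝ (Fin (d + 1)) → ℝ) (hfmeas : Measurable f)
    (hfLp : IntegrableOn
      (fun x : EuclideanSpace ℝ (Fin (d + 1)) =>
        |f x| ^ p * (x (Fin.last d)) ^ (a * p)) (upperHalf d)) :
    (∀ᵐ x ∂(volume.restrict (upperHalf d)),
      IntegrableOn
        (fun y => Q ((x (Fin.last d))⁻¹ • (y - x)) * f y) (upperHalf d)) ∧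
    (∫ x in upperHalf d,
        |(x (Fin.last d)) ^ (-((d : ℝ) + 1)) *
            ∫ y in upperHalf d, Q ((x (Fin.last d))⁻¹ • (y - x)) * f y| ^ p *
          (x (Fin.last d)) ^ (a * p)) ^ (1 / p)
      ≤ (∫ ζ in upperHalf d,
            Q (ζ - EuclideanSpace.single (Fin.last d) (1 : ℝ)) *
              (ζ (Fin.last d)) ^ (-a - 1 / p)) *
        (∫ x in upperHalf d, |f x| ^ p * (x (Fin.last d)) ^ (a * p)) ^ (1 / p) := by
  have hp0 : 0 < p := by linarith
  have hH := measurableSet_upperHalf d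
  set e := EuclideanSpace.single (Fin.last d) (1 : ℝ) with he
  set A := ∫ ζ in upperHalf d, Q (ζ - e) * (ζ (Fin.last d)) ^ (-a - 1 / p)
  set N := ∫ x in upperHalf d, |f x| ^ p * (x (Fin.last d)) ^ (a * p)
  set G : EuclideanSpace ℝ (Fin (d + 1)) → ℝ≥0∞ := fun x =>
    ∫⁻ ζ in upperHalf d, ‖Q (ζ - e)‖ₑ * ‖f (x + x (Fin.last d) • (ζ - e))‖ₑ with hG
  have hQ0 : ∀ ζ ∈ upperHalf d, 0 ≤ Q (ζ - e) := by
    intro ζ hζ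
    have hζ' : 0 < ζ (Fin.last d) := hζ
    exact hQnonneg _ (by simp [he, hζ'])
  have hA0 : ∀ ζ ∈ upperHalf d, 0 ≤ Q (ζ - e) * (ζ (Fin.last d)) ^ (-a - 1 / p) := by
    intro ζ hζ
    have hζ' : 0 < ζ (Fin.last d) := hζ
    exact mul_nonneg (hQ0 ζ hζ) (by positivity)
  have hN0 : ∀ x ∈ upperHalf d, 0 ≤ |f x| ^ p * (x (Fin.last d)) ^ (a * p) := by
    intro x hx
    have hx' : 0 < x (Fin.last d) := hx
    positivity
  have hAnn : 0 ≤ A := setIntegral_nonneg hH hA0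
  have hNnn : 0 ≤ N := setIntegral_nonneg hH hN0
  have hAeq : ∫⁻ ζ in upperHalf d, ‖Q (ζ - e)‖ₑ *
      ENNReal.ofReal (ζ (Fin.last d) ^ (-a - 1 / p)) = ENNReal.ofReal A := by
    rw [ofReal_integral_eq_lintegral_ofReal hQint (ae_restrict_of_forall_mem hH hA0)]
    refine setLIntegral_congr_fun hH fun ζ hζ => ?_
    simp only
    rw [ENNReal.ofReal_mul (hQ0 ζ hζ), Real.enorm_of_nonneg (hQ0 ζ hζ)]
  have hNeq : ∫⁻ x in upperHalf d, ‖f x‖ₑ ^ p * ENNReal.ofReal (x (Fin.last d) ^ (a * p))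
      = ENNReal.ofReal N := by
    rw [ofReal_integral_eq_lintegral_ofReal hfLp (ae_restrict_of_forall_mem hH hN0)]
    refine setLIntegral_congr_fun hH fun x hx => ?_
    simp only
    rw [ENNReal.ofReal_mul (by positivity), ← ENNReal.ofReal_rpow_of_nonneg (abs_nonneg _) hp0.le,
      Real.enorm_eq_ofReal_abs]
  have hbound : ∫⁻ x in upperHalf d, G x ^ p * ENNReal.ofReal (x (Fin.last d) ^ (a * p))
      ≤ ENNReal.ofReal (A ^ p * N) := by
    have h := lintegral_upperHalf_dilation_average_le d a hp (q := fun ζ => ‖Q (ζ - e)‖ₑ)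
      (g := fun x => ‖f x‖ₑ) (by fun_prop) (by fun_prop)
    rw [hAeq, hNeq, ENNReal.ofReal_rpow_of_nonneg hAnn hp0.le,
      ← ENNReal.ofReal_mul (by positivity)] at h
    exact h
  have hGm : Measurable G := by
    have : Measurable (Function.uncurry fun x ζ : EuclideanSpace ℝ (Fin (d + 1)) =>
        ‖Q (ζ - e)‖ₑ * ‖f (x + x (Fin.last d) • (ζ - e))‖ₑ) := by
      simp only [Function.uncurry_def]; fun_prop
    exact this.lintegral_prod_right'
  have hker : ∀ x ∈ upperHalf d,
      ∫⁻ y in upperHalf d, ‖Q ((x (Fin.last d))⁻¹ • (y - x)) * f y‖ₑ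
        = ENNReal.ofReal (x (Fin.last d) ^ (d + 1)) * G x := by
    intro x hx
    have hx' : x (Fin.last d) ≠ 0 := ne_of_gt hx
    rw [setLIntegral_upperHalf_dilation d hx (by fun_prop)]
    simp only [add_sub_cancel_left, smul_smul, inv_mul_cancel₀ hx', one_smul, enorm_mul, hG, ← he]
  constructor
  · have hfin := ae_lt_top (μ := volume.restrict (upperHalf d))
      (f := fun x => G x ^ p * ENNReal.ofReal (x (Fin.last d) ^ (a * p))) (by fun_prop)
      (hbound.trans_lt ENNReal.ofReal_lt_top).ne
    filter_upwards [hfin, ae_restrict_mem hH] with x hx hxH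
    have hx' : 0 < x (Fin.last d) := hxH
    have hw : ENNReal.ofReal (x (Fin.last d) ^ (a * p)) ≠ 0 := by
      simpa using Real.rpow_pos_of_pos hx' _
    have hGx : G x < ∞ := by
      by_contra! htop
      rw [top_le_iff.1 htop, ENNReal.top_rpow_of_pos hp0, ENNReal.top_mul hw] at hx
      exact lt_irrefl _ hx
    refine ⟨by fun_prop, ?_⟩
    rw [hasFiniteIntegral_iff_enorm, hker x hxH]
    exact ENNReal.mul_lt_top ENNReal.ofReal_lt_top hGx
  · have hI : ∫ x in upperHalf d,
        |(x (Fin.last d)) ^ (-((d : ℝ) + 1)) *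
            ∫ y in upperHalf d, Q ((x (Fin.last d))⁻¹ • (y - x)) * f y| ^ p *
          (x (Fin.last d)) ^ (a * p) ≤ A ^ p * N := by
      rw [← ENNReal.ofReal_le_ofReal_iff (by positivity)]
      refine le_trans ?_ hbound
      refine (Real.ofReal_le_enorm _).trans ((enorm_integral_le_lintegral_enorm _).trans ?_)
      refine setLIntegral_mono (by fun_prop) fun x hx => ?_
      have hx' : 0 < x (Fin.last d) := hx
      rw [enorm_mul, Real.enorm_of_nonneg (by positivity : 0 ≤ x (Fin.last d) ^ (a * p)),
        Real.enorm_of_nonneg (by positivity), ← ENNReal.ofReal_rpow_of_nonneg (abs_nonneg _) hp0.le,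
        ← Real.enorm_eq_ofReal_abs, enorm_mul]
      gcongr
      refine (mul_le_mul_right (enorm_integral_le_lintegral_enorm _) _).trans_eq ?_
      rw [hker x hx, ← mul_assoc, Real.enorm_of_nonneg (by positivity),
        ← ENNReal.ofReal_mul (by positivity), Real.rpow_neg hx'.le]
      have : x (Fin.last d) ^ ((d : ℝ) + 1) = x (Fin.last d) ^ (d + 1) := by
        rw [← Real.rpow_natCast, Nat.cast_succ]
      rw [this, inv_mul_cancel₀ (by positivity), ENNReal.ofReal_one, one_mul]
    refine (Real.rpow_le_rpow (setIntegral_nonneg hH fun x hx => ?_) hI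
      (by positivity)).trans_eq ?_
    · have hx' : 0 < x (Fin.last d) := hx
      positivity
    · rw [Real.mul_rpow (by positivity) hNnn, ← Real.rpow_mul hAnn, mul_one_div_cancel hp0.ne',
        Real.rpow_one]
end

section
/- Let n ≥ 2, let Ω be a nonempty open subset of ℝ^n with Ω ≠ ℝ^n, and set ρ(X) := dist(X, ∂Ω) for X ∈ Ω. Let 1 < p < ∞, 0 < s < 1, let m ≥ 1 be an integer and let τ ∈ ℕ_0^n be a multi-index with |τ| ≤ m−1. Then there exists a constant C depending only on n, p, s, m, |τ| and μ, for any fixed μ > 1, such that for all Y, Z ∈ ∂Ω with Y ≠ Z: ∫_{{X ∈ Ω : |X−Y| < μρ(X) and |X−Z| < μρ(X)}} ρ(X)^{p(−m+1−s+|τ|)−2n+1} dX ≤ C · |Y − Z|^{p(−m+1+|τ|−s)−n+1}. -/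
open MeasureTheory

/-- The function `x ↦ (d + dist x y) ^ (-r)` is integrable for `r` above the dimension, and its
integral scales like `d ^ (-r + dim E)`. -/
theorem integrable_add_dist_rpow {E : Type*} [NormedAddCommGroup E] [NormedSpace ℝ E]
    [FiniteDimensional ℝ E] [MeasurableSpace E] [BorelSpace E] (ν : Measure E)
    [ν.IsAddHaarMeasure] {r d : ℝ} (hr : (Module.finrank ℝ E : ℝ) < r) (hd : 0 < d) (y : E) :
    Integrable (fun x => (d + dist x y) ^ (-r)) ν ∧
      ∫ x, (d + dist x y) ^ (-r) ∂ν =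
        d ^ (-r + Module.finrank ℝ E) * ∫ x, (1 + ‖x‖) ^ (-r) ∂ν := by
  have scale : (fun x => (d + dist x y) ^ (-r)) =
      fun x => (fun w : E => d ^ (-r) * (1 + ‖d⁻¹ • w‖) ^ (-r)) (x - y) := by
    funext x
    simp only
    rw [dist_eq_norm, ← Real.mul_rpow hd.le (by positivity), norm_smul, norm_inv,
      Real.norm_of_nonneg hd.le]
    congr 1
    field_simp
  rw [scale]
  constructor
  · exact (((integrable_one_add_norm hr).comp_smul
      (inv_ne_zero hd.ne')).const_mul _).comp_sub_right y
  · rw [integral_sub_right_eq_self (fun w : E => d ^ (-r) * (1 + ‖d⁻¹ • w‖) ^ (-r)) y,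
      integral_const_mul,
      Measure.integral_comp_inv_smul ν (fun w : E => (1 + ‖w‖) ^ (-r)) d,
      Real.rpow_add hd, Real.rpow_natCast, abs_of_pos (by positivity), smul_eq_mul, mul_assoc]

/-- Geometric weighted estimate: for `1 < p < ∞`, `0 < s < 1`,
`m ≥ 1`, a multi-index `τ` with `|τ| ≤ m-1` and `μ > 1`, there is a constant
`C = C(n, p, s, m, |τ|, μ) > 0` such that for every nonempty open proper subset `Ω` of
`ℝ^n` (with `ρ(X) = dist(X, ∂Ω)`) and all distinct `Y, Z ∈ ∂Ω`,
`∫_{{X ∈ Ω : |X-Y| < μρ(X), |X-Z| < μρ(X)}} ρ(X)^{p(-m+1-s+|τ|)-2n+1} dX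
  ≤ C |Y-Z|^{p(-m+1+|τ|-s)-n+1}`. -/
theorem statement18 (n : ℕ) (hn : 2 ≤ n) (p s : ℝ) (hp : 1 < p) (hs0 : 0 < s)
    (hs1 : s < 1) (m : ℕ) (hm : 1 ≤ m) (τ : Fin n → ℕ) (hτ : (∑ i, τ i) ≤ m - 1)
    (μ : ℝ) (hμ : 1 < μ) :
    ∃ C : ℝ, 0 < C ∧ ∀ Ω : Set (EuclideanSpace ℝ (Fin n)), IsOpen Ω → Ω.Nonempty →
      Ω ≠ Set.univ →
      ∀ Y Z : EuclideanSpace ℝ (Fin n), Y ∈ frontier Ω → Z ∈ frontier Ω → Y ≠ Z →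
        (∫ X in {X : EuclideanSpace ℝ (Fin n) | X ∈ Ω ∧
              dist X Y < μ * Metric.infDist X (frontier Ω) ∧
              dist X Z < μ * Metric.infDist X (frontier Ω)},
            (Metric.infDist X (frontier Ω)) ^
              (p * (-(m : ℝ) + 1 - s + (∑ i, τ i : ℕ)) - 2 * n + 1))
          ≤ C * (dist Y Z) ^ (p * (-(m : ℝ) + 1 + (∑ i, τ i : ℕ) - s) - n + 1) := by
  set r : ℝ := -(p * (-(m : ℝ) + 1 - s + (∑ i, τ i : ℕ)) - 2 * n + 1) with hr
  have hτ' : ((∑ i, τ i : ℕ) : ℝ) + 1 ≤ m := by exact_mod_cast (by omega : (∑ i, τ i) + 1 ≤ m)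
  have hn' : (2 : ℝ) ≤ n := by exact_mod_cast hn
  have hneg : p * (-(m : ℝ) + 1 - s + (∑ i, τ i : ℕ)) < 0 :=
    mul_neg_of_pos_of_neg (by linarith) (by linarith)
  have hrn : (Module.finrank ℝ (EuclideanSpace ℝ (Fin n)) : ℝ) < r := by
    rw [finrank_euclideanSpace_fin, hr]
    linarith
  have hr0 : 0 < r := lt_of_le_of_lt (Nat.cast_nonneg _) hrn
  have hexp : p * (-(m : ℝ) + 1 - s + (∑ i, τ i : ℕ)) - 2 * n + 1 = -r := by rw [hr]; ring
  have hexp' : p * (-(m : ℝ) + 1 + (∑ i, τ i : ℕ) - s) - n + 1 =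
      -r + Module.finrank ℝ (EuclideanSpace ℝ (Fin n)) := by
    rw [hr, finrank_euclideanSpace_fin]; ring
  set I : ℝ := ∫ x : EuclideanSpace ℝ (Fin n), (1 + ‖x‖) ^ (-r) with hI
  have hI0 : 0 ≤ I := integral_nonneg fun x => by positivity
  have hμ0 : 0 < 3 * μ := by linarith
  refine ⟨(3 * μ) ^ r * I + 1, by positivity, fun Ω hΩ _ _ Y Z _ _ hYZ => ?_⟩
  rw [hexp, hexp']
  have hd : 0 < dist Y Z := dist_pos.mpr hYZ
  obtain ⟨hint, hval⟩ := integrable_add_dist_rpow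
    (volume : Measure (EuclideanSpace ℝ (Fin n))) hrn hd Y
  have hcont := Metric.continuous_infDist_pt (frontier Ω)
  have hmeas : MeasurableSet {X : EuclideanSpace ℝ (Fin n) | X ∈ Ω ∧
      dist X Y < μ * Metric.infDist X (frontier Ω) ∧
      dist X Z < μ * Metric.infDist X (frontier Ω)} := by
    have hopen (W : EuclideanSpace ℝ (Fin n)) :
        IsOpen {X | dist X W < μ * Metric.infDist X (frontier Ω)} :=
      isOpen_lt (by fun_prop) (by fun_prop)
    exact (hΩ.inter ((hopen Y).inter (hopen Z))).measurableSet
  calc _ ≤ ∫ X in {X : EuclideanSpace ℝ (Fin n) | X ∈ Ω ∧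
          dist X Y < μ * Metric.infDist X (frontier Ω) ∧
          dist X Z < μ * Metric.infDist X (frontier Ω)},
          (3 * μ) ^ r * (dist Y Z + dist X Y) ^ (-r) := by
        refine integral_mono_of_nonneg
          (ae_of_all _ fun X => Real.rpow_nonneg Metric.infDist_nonneg _)
          (hint.const_mul _).integrableOn ?_
        filter_upwards [ae_restrict_mem hmeas] with X hX
        obtain ⟨-, h1, h2⟩ := hX
        have htri : dist Y Z ≤ dist X Y + dist X Z := dist_triangle_left Y Z X
        have hle : (dist Y Z + dist X Y) / (3 * μ) ≤ Metric.infDist X (frontier Ω) := by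
          rw [div_le_iff₀ hμ0]
          linarith
        have hpos : 0 < dist Y Z + dist X Y := by positivity
        calc Metric.infDist X (frontier Ω) ^ (-r)
            ≤ ((dist Y Z + dist X Y) / (3 * μ)) ^ (-r) :=
              Real.rpow_le_rpow_of_nonpos (by positivity) hle (by linarith)
          _ = (3 * μ) ^ r * (dist Y Z + dist X Y) ^ (-r) := by
              rw [Real.div_rpow hpos.le hμ0.le, Real.rpow_neg hμ0.le, div_inv_eq_mul, mul_comm]
    _ ≤ ∫ X, (3 * μ) ^ r * (dist Y Z + dist X Y) ^ (-r) :=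
        setIntegral_le_integral (hint.const_mul _) (ae_of_all _ fun X => by
          simp only [Pi.zero_apply]; positivity)
    _ = (3 * μ) ^ r * I *
          dist Y Z ^ (-r + Module.finrank ℝ (EuclideanSpace ℝ (Fin n)) : ℝ) := by
        rw [integral_const_mul, hval]; ring
    _ ≤ _ := by
        gcongr
        linarith
end
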